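/- Let q be a prime power, m ≥ 4 an even integer, and r = q+1. Let l, i, ī be integers with 1 ≤ l ≤ m/2 − 1, 0 ≤ i ≤ δ^max − 3, and 0 ≤ ī ≤ δ^max − 2. If (1+r·i)·q^{2l} ≡ 1+r·ī (mod q^{2m}−1), then in fact (1+r·i)·q^{2l} = 1+r·ī as integers, and consequently ī ≡ q−1 (mod q²). -/

import Mathlib

/-- The maximum design distance `δ^max = (q^{m+1}−q²+q+3)/(q+1)` for `m ≥ 4`. -/
def deltaMax (q m : ℕ) : ℕ := (q ^ (m + 1) - q ^ 2 + q + 3) / (q + 1)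

theorem mul_deltaMax_sub_lt (q m k : ℕ) (hq : 2 ≤ q) (hk : 2 ≤ k) :
    (q + 1) * (deltaMax q m - k) < q ^ (m + 1) := by
  have hdiv : (q + 1) * deltaMax q m ≤ q ^ (m + 1) - q ^ 2 + q + 3 := Nat.mul_div_le _ _
  have hmul : (q + 1) * 2 ≤ (q + 1) * k := Nat.mul_le_mul_left _ hk
  have hpos : 0 < q ^ (m + 1) := by positivity
  have hsq : 2 * 2 ≤ q ^ 2 := by nlinarith
  rw [Nat.mul_sub]
  omega

theorem modEq_sq_of_sq_dvd (q x : ℕ) (hq : 1 ≤ q) (h : q ^ 2 ∣ 1 + (q + 1) * x) :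
    x ≡ q - 1 [MOD q ^ 2] := by
  have hcop : Nat.gcd (q ^ 2) (q + 1) = 1 :=
    Nat.Coprime.pow_left 2 (by simp)
  have hsq : 1 + (q + 1) * (q - 1) = q ^ 2 := by
    obtain ⟨n, rfl⟩ := Nat.exists_eq_add_of_le' hq
    simp only [Nat.add_sub_cancel]
    ring
  refine Nat.ModEq.cancel_left_of_coprime hcop (Nat.ModEq.add_left_cancel' 1 ?_)
  rw [hsq]
  exact (Nat.modEq_zero_iff_dvd.2 h).trans (Nat.modEq_zero_iff_dvd.2 dvd_rfl).symm

theorem stmt16 (q m : ℕ) (hq : IsPrimePow q) (hm : 4 ≤ m) (hme : Even m)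
    (r : ℕ) (hr : r = q + 1)
    (l i ibar : ℕ) (hl1 : 1 ≤ l) (hl2 : l ≤ m / 2 - 1)
    (hi : i ≤ deltaMax q m - 3) (hibar : ibar ≤ deltaMax q m - 2)
    (hc : (1 + r * i) * q ^ (2 * l) ≡ 1 + r * ibar [MOD q ^ (2 * m) - 1]) :
    (1 + r * i) * q ^ (2 * l) = 1 + r * ibar ∧ ibar ≡ q - 1 [MOD q ^ 2] := by
  subst hr
  have hq2 : 2 ≤ q := hq.two_le
  have hq1 : 1 ≤ q := by omega
  have hA : 1 + (q + 1) * i ≤ q ^ (m + 1) := by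
    have := mul_deltaMax_sub_lt q m 3 hq2 (by norm_num)
    have := Nat.mul_le_mul_left (q + 1) hi
    omega
  have hB : 1 + (q + 1) * ibar ≤ q ^ (m + 1) := by
    have := mul_deltaMax_sub_lt q m 2 hq2 le_rfl
    have := Nat.mul_le_mul_left (q + 1) hibar
    omega
  have hlt : q ^ (2 * m - 1) < q ^ (2 * m) - 1 := by
    have hsucc : q ^ (2 * m) = q ^ (2 * m - 1) * q := by
      rw [← pow_succ]; congr 1; omega
    have hlow : 2 ≤ q ^ (2 * m - 1) := hq2.trans (Nat.le_self_pow (by omega) q)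
    have hdouble : q ^ (2 * m - 1) * 2 ≤ q ^ (2 * m - 1) * q := Nat.mul_le_mul_left _ hq2
    omega
  have hA' : (1 + (q + 1) * i) * q ^ (2 * l) ≤ q ^ (2 * m - 1) :=
    calc (1 + (q + 1) * i) * q ^ (2 * l) ≤ q ^ (m + 1) * q ^ (2 * l) :=
          Nat.mul_le_mul_right _ hA
      _ = q ^ (m + 1 + 2 * l) := (pow_add _ _ _).symm
      _ ≤ q ^ (2 * m - 1) := Nat.pow_le_pow_right hq1 (by omega)
  have hB' : 1 + (q + 1) * ibar ≤ q ^ (2 * m - 1) :=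
    hB.trans (Nat.pow_le_pow_right hq1 (by omega))
  have heq : (1 + (q + 1) * i) * q ^ (2 * l) = 1 + (q + 1) * ibar :=
    hc.eq_of_lt_of_lt (hA'.trans_lt hlt) (hB'.trans_lt hlt)
  refine ⟨heq, modEq_sq_of_sq_dvd q ibar hq1 ?_⟩
  rw [← heq]
  exact (pow_dvd_pow q (by omega)).mul_left _
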